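/- arXiv:2104.01067 — 4 statements merged into one kernel-verified Lean document; each statement's English description precedes it below -/
import Mathlib

section
/- For all real numbers s ≤ s', the expectation of log(1 + X) under the Poisson distribution satisfies 0 ≤ E[log(1 + X_{e^{s'}})] − E[log(1 + X_{e^{s}})] ≤ s' − s, where X_μ denotes a Poisson random variable with parameter μ. In other words, the map s ↦ E[log(1 + X_{e^s})] is nondecreasing and 1-Lipschitz on ℝ. -/
lemma plm_summable (a : ℕ → ℝ) (ha : ∀ k, |a k| ≤ 2 * 2 ^ k) (x : ℝ) :
    Summable (fun k : ℕ => a k * (x ^ k / (Nat.factorial k))) := by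
  have h := (Real.summable_pow_div_factorial (2 * |x|)).mul_left 2
  refine Summable.of_norm_bounded h (fun k => ?_)
  rw [Real.norm_eq_abs, abs_mul, abs_div, abs_pow, Nat.abs_cast, mul_pow]
  calc |a k| * (|x| ^ k / (Nat.factorial k)) ≤ (2 * 2 ^ k) * (|x| ^ k / (Nat.factorial k)) :=
        mul_le_mul_of_nonneg_right (ha k) (by positivity)
    _ = _ := by ring

lemma plm_deriv (a : ℕ → ℝ) (ha : ∀ k, |a k| ≤ 2 ^ k) (x : ℝ) :
    HasDerivAt (fun y => ∑' k : ℕ, a k * (y ^ k / (Nat.factorial k)))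
      (∑' k : ℕ, a (k + 1) * (x ^ k / (Nat.factorial k))) x := by
  have hfac : ∀ (k : ℕ) (y : ℝ), ((k + 1 : ℕ) : ℝ) * y ^ k / (Nat.factorial (k + 1))
      = y ^ k / (Nat.factorial k) := by
    intro k y
    rw [Nat.factorial_succ]
    push_cast
    field_simp
  set R : ℝ := |x| + 1 with hR
  have hR0 : 0 < R := by positivity
  let u : ℕ → ℝ := fun k => 2 ^ k * ((k : ℝ) * R ^ (k - 1) / (Nat.factorial k))
  have hu : Summable u := by
    rw [← summable_nat_add_iff 1]
    refine (plm_summable (fun k => 2 * 2 ^ k) (fun k => ?_) R).congr (fun k => ?_)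
    · rw [abs_of_nonneg (by positivity)]
    · simp only [u, Nat.add_sub_cancel]
      rw [hfac]
      ring
  have hx : x ∈ Metric.ball (0 : ℝ) R := by
    simp [hR]
  have hb : ∀ (n : ℕ) (y : ℝ), y ∈ Metric.ball (0 : ℝ) R →
      ‖a n * ((n : ℝ) * y ^ (n - 1) / (Nat.factorial n))‖ ≤ u n := by
    intro n y hy
    have hy' : |y| ≤ R := by
      have := Metric.mem_ball.1 hy
      rw [dist_zero_right, Real.norm_eq_abs] at this
      exact this.le
    rw [Real.norm_eq_abs, abs_mul, abs_div, abs_mul, abs_pow, Nat.abs_cast, Nat.abs_cast]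
    simp only [u]
    have := ha n
    gcongr
  have key := hasDerivAt_tsum_of_isPreconnected
    (g := fun k y => a k * (y ^ k / (Nat.factorial k)))
    (g' := fun k y => a k * ((k : ℝ) * y ^ (k - 1) / (Nat.factorial k)))
    hu Metric.isOpen_ball (convex_ball (0 : ℝ) R).isPreconnected
    (fun n y _ => ((hasDerivAt_pow n y).div_const _).const_mul _) hb hx
    (plm_summable a (fun k => (ha k).trans (by
      have : (0 : ℝ) < 2 ^ k := by positivity
      linarith)) x) hx
  have hs : Summable (fun k : ℕ => a k * ((k : ℝ) * x ^ (k - 1) / (Nat.factorial k))) :=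
    Summable.of_norm_bounded hu (fun k => hb k x hx)
  have heq : (∑' k : ℕ, a (k + 1) * (x ^ k / (Nat.factorial k)))
      = ∑' k : ℕ, a k * ((k : ℝ) * x ^ (k - 1) / (Nat.factorial k)) := by
    rw [hs.tsum_eq_zero_add]
    simp only [Nat.cast_zero, zero_mul, zero_div, mul_zero, zero_add, Nat.add_sub_cancel]
    exact tsum_congr fun k => by rw [hfac]
  rw [heq]
  exact key

/-- The exponential generating function of `log (1 + k)`. -/
noncomputable def plmG (x : ℝ) : ℝ :=
  ∑' k : ℕ, Real.log (1 + (k : ℝ)) * (x ^ k / (Nat.factorial k))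

/-- The exponential generating function of `log (2 + k)`. -/
noncomputable def plmH (x : ℝ) : ℝ :=
  ∑' k : ℕ, Real.log (1 + ((k + 1 : ℕ) : ℝ)) * (x ^ k / (Nat.factorial k))

lemma plm_log_bound (k : ℕ) : |Real.log (1 + (k : ℝ))| ≤ k := by
  have h0 : (0 : ℝ) ≤ k := Nat.cast_nonneg k
  rw [abs_of_nonneg (Real.log_nonneg (by linarith))]
  have := Real.log_le_sub_one_of_pos (show (0 : ℝ) < 1 + k by linarith)
  linarith

lemma plm_two_pow (k : ℕ) : (k : ℝ) ≤ 2 ^ k := by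
  exact_mod_cast (Nat.lt_two_pow_self (n := k)).le

lemma plm_diff (x : ℝ) (hx : 0 ≤ x) : 0 ≤ plmH x - plmG x ∧
    x * (plmH x - plmG x) ≤ Real.exp x := by
  have h1 : Summable (fun k : ℕ => Real.log (1 + (k : ℝ)) * (x ^ k / (Nat.factorial k))) :=
    plm_summable _ (fun k => (plm_log_bound k).trans ((plm_two_pow k).trans (by
      have : (0 : ℝ) < 2 ^ k := by positivity
      linarith))) x
  have h2 : Summable (fun k : ℕ => Real.log (1 + ((k + 1 : ℕ) : ℝ)) *
      (x ^ k / (Nat.factorial k))) :=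
    plm_summable _ (fun k => (plm_log_bound (k + 1)).trans ((plm_two_pow (k + 1)).trans (by
      rw [pow_succ]
      linarith))) x
  have hd : plmH x - plmG x = ∑' k : ℕ, (Real.log (1 + ((k + 1 : ℕ) : ℝ)) *
      (x ^ k / (Nat.factorial k)) - Real.log (1 + (k : ℝ)) * (x ^ k / (Nat.factorial k))) :=
    (h2.tsum_sub h1).symm
  have hterm : ∀ k : ℕ, 0 ≤ Real.log (1 + ((k + 1 : ℕ) : ℝ)) - Real.log (1 + (k : ℝ)) ∧
      Real.log (1 + ((k + 1 : ℕ) : ℝ)) - Real.log (1 + (k : ℝ)) ≤ 1 / (k + 1) := by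
    intro k
    have h0 : (0 : ℝ) ≤ k := Nat.cast_nonneg k
    have p1 : (0 : ℝ) < 1 + k := by linarith
    have p2 : (0 : ℝ) < 1 + ((k + 1 : ℕ) : ℝ) := by positivity
    constructor
    · rw [sub_nonneg]
      apply Real.log_le_log p1
      push_cast
      linarith
    · rw [← Real.log_div p2.ne' p1.ne']
      refine (Real.log_le_sub_one_of_pos (by positivity)).trans (le_of_eq ?_)
      push_cast
      field_simp
      ring
  constructor
  · rw [hd]
    refine tsum_nonneg fun k => ?_
    rw [← sub_mul]
    exact mul_nonneg (hterm k).1 (by positivity)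
  · rw [hd, ← tsum_mul_left]
    have he : Summable (fun k : ℕ => x ^ k / (Nat.factorial k : ℝ)) :=
      Real.summable_pow_div_factorial x
    have hexp : Real.exp x = ∑' k : ℕ, x ^ k / (Nat.factorial k : ℝ) := by
      rw [Real.exp_eq_exp_ℝ, NormedSpace.exp_eq_tsum_div]
    have hs := (summable_nat_add_iff 1).2 he
    have h3 : ∑' k : ℕ, x ^ (k + 1) / (Nat.factorial (k + 1) : ℝ) ≤ Real.exp x := by
      rw [hexp, he.tsum_eq_zero_add]
      simp
    refine le_trans (((h2.sub h1).mul_left x).tsum_le_tsum (fun k => ?_) hs) h3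
    rw [← sub_mul]
    have e : x ^ (k + 1) / (Nat.factorial (k + 1) : ℝ)
        = x * (1 / (k + 1) * (x ^ k / (Nat.factorial k))) := by
      rw [Nat.factorial_succ]
      push_cast
      field_simp
      ring
    rw [e]
    exact mul_le_mul_of_nonneg_left
      (mul_le_mul_of_nonneg_right (hterm k).2 (by positivity)) hx

/-- The Poisson mean as a function of `s`. -/
noncomputable def plmF (s : ℝ) : ℝ := Real.exp (-(Real.exp s)) * plmG (Real.exp s)

lemma plmF_eq (s : ℝ) : (∑' k : ℕ, Real.log (1 + (k : ℝ)) *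
    (Real.exp (-(Real.exp s)) * (Real.exp s) ^ k / (Nat.factorial k))) = plmF s := by
  rw [plmF, plmG, ← tsum_mul_left]
  exact tsum_congr fun k => by ring

lemma plmF_deriv (s : ℝ) : HasDerivAt plmF
    (Real.exp (-(Real.exp s)) * (Real.exp s * (plmH (Real.exp s) - plmG (Real.exp s)))) s := by
  have hG : HasDerivAt plmG (plmH (Real.exp s)) (Real.exp s) :=
    plm_deriv (fun k => Real.log (1 + (k : ℝ)))
      (fun k => (plm_log_bound k).trans (plm_two_pow k)) _
  have h1 := hG.comp s (Real.hasDerivAt_exp s)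
  have h2 := ((Real.hasDerivAt_exp s).neg).exp
  refine (h2.mul h1).congr_deriv ?_
  simp only [Function.comp, Pi.neg_apply]
  ring

/-- For all reals `s ≤ s'`, the expectation of `log(1 + X)` under the
Poisson distribution satisfies
`0 ≤ E[log(1 + X_{e^{s'}})] − E[log(1 + X_{e^{s}})] ≤ s' − s`,
i.e. the map `s ↦ E[log(1 + X_{e^s})]` is nondecreasing and 1-Lipschitz on `ℝ`. -/
theorem poisson_log_mean_monotone_lipschitz (s s' : ℝ) (h : s ≤ s') :
    0 ≤ (∑' k : ℕ, Real.log (1 + (k : ℝ)) *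
            (Real.exp (-(Real.exp s')) * (Real.exp s') ^ k / (Nat.factorial k)))
        - (∑' k : ℕ, Real.log (1 + (k : ℝ)) *
            (Real.exp (-(Real.exp s)) * (Real.exp s) ^ k / (Nat.factorial k))) ∧
    (∑' k : ℕ, Real.log (1 + (k : ℝ)) *
            (Real.exp (-(Real.exp s')) * (Real.exp s') ^ k / (Nat.factorial k)))
        - (∑' k : ℕ, Real.log (1 + (k : ℝ)) *
            (Real.exp (-(Real.exp s)) * (Real.exp s) ^ k / (Nat.factorial k)))
      ≤ s' - s := by
  rw [plmF_eq, plmF_eq]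
  have hm : Monotone plmF := monotone_of_hasDerivAt_nonneg plmF_deriv (fun t =>
    mul_nonneg (Real.exp_pos _).le
      (mul_nonneg (Real.exp_pos _).le (plm_diff _ (Real.exp_pos t).le).1))
  have hm2 : Monotone (fun t => t - plmF t) := by
    refine monotone_of_hasDerivAt_nonneg (fun t => (hasDerivAt_id t).sub (plmF_deriv t))
      (fun t => ?_)
    have h1 := mul_le_mul_of_nonneg_left (plm_diff _ (Real.exp_pos t).le).2
      (Real.exp_pos (-(Real.exp t))).le
    rw [← Real.exp_add, neg_add_cancel, Real.exp_zero] at h1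
    simpa using h1
  have a1 := hm h
  have a2 := hm2 h
  simp only at a2
  constructor <;> linarith
end

section
/- There exists a constant δ₁ > 0 such that for every x ∈ ℝ, x² ≤ δ₁ (1 − log Φ(x) − log(1 − Φ(x))). Equivalently, the standard normal quantile function satisfies Φ^{-1}(u)² ≤ δ₁ (1 − log u − log(1−u)) for all u ∈ (0,1). -/
open MeasureTheory

/-- The standard normal cumulative distribution function
`Φ(x) = ∫_{-∞}^{x} (2π)^{-1/2} e^{-t²/2} dt`. -/
noncomputable def stdGaussCDF (x : ℝ) : ℝ :=
  ∫ t in Set.Iic x, (Real.sqrt (2 * Real.pi))⁻¹ * Real.exp (-t ^ 2 / 2)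


lemma stdGaussCDF_eq_real (x : ℝ) :
    stdGaussCDF x = (ProbabilityTheory.gaussianReal 0 1).real (Set.Iic x) := by
  rw [measureReal_def, ProbabilityTheory.gaussianReal_apply_eq_integral 0 one_ne_zero,
    ENNReal.toReal_ofReal]
  · simp [stdGaussCDF, ProbabilityTheory.gaussianPDFReal]
  · exact integral_nonneg fun t => ProbabilityTheory.gaussianPDFReal_nonneg _ _ _

lemma one_sub_stdGaussCDF_eq_real (x : ℝ) :
    1 - stdGaussCDF x = (ProbabilityTheory.gaussianReal 0 1).real (Set.Ioi x) := by
  rw [stdGaussCDF_eq_real, ← Set.compl_Iic, probReal_compl_eq_one_sub measurableSet_Iic]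

lemma gaussian_real_pos {s : Set ℝ} (hs : volume s ≠ 0) :
    0 < (ProbabilityTheory.gaussianReal 0 1).real s := by
  rw [measureReal_def]
  refine ENNReal.toReal_pos (fun h => hs ?_) (measure_ne_top _ _)
  exact ProbabilityTheory.gaussianReal_absolutelyContinuous' 0 one_ne_zero h

lemma gaussian_subG :
    ProbabilityTheory.HasSubgaussianMGF id 1 (ProbabilityTheory.gaussianReal 0 1) where
  integrable_exp_mul t := ProbabilityTheory.integrable_exp_mul_gaussianReal t
  mgf_le t := by
    rw [ProbabilityTheory.mgf_id_gaussianReal]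
    simp

theorem stdGauss_quantile_sq_bound :
    ∃ δ₁ : ℝ, 0 < δ₁ ∧ ∀ x : ℝ,
      x ^ 2 ≤ δ₁ * (1 - Real.log (stdGaussCDF x) - Real.log (1 - stdGaussCDF x)) := by
  refine ⟨2, two_pos, fun x => ?_⟩
  have h1 : 0 < stdGaussCDF x := by
    rw [stdGaussCDF_eq_real]; exact gaussian_real_pos (by simp)
  have h2 : 0 < 1 - stdGaussCDF x := by
    rw [one_sub_stdGaussCDF_eq_real]; exact gaussian_real_pos (by simp)
  have l1 : Real.log (stdGaussCDF x) ≤ 0 := Real.log_nonpos h1.le (by linarith)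
  have l2 : Real.log (1 - stdGaussCDF x) ≤ 0 := Real.log_nonpos h2.le (by linarith)
  rcases le_total 0 x with hx | hx
  · have h := gaussian_subG.measure_ge_le hx
    have h3 : 1 - stdGaussCDF x ≤ Real.exp (-x ^ 2 / 2) := by
      rw [one_sub_stdGaussCDF_eq_real]
      refine (measureReal_mono ?_).trans (h.trans (by simp))
      intro t ht
      exact le_of_lt (Set.mem_Ioi.1 ht)
    have h4 := Real.log_le_log h2 h3
    rw [Real.log_exp] at h4
    linarith
  · have h := gaussian_subG.neg.measure_ge_le (neg_nonneg.2 hx)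
    have h3 : stdGaussCDF x ≤ Real.exp (-x ^ 2 / 2) := by
      rw [stdGaussCDF_eq_real]
      refine (measureReal_mono ?_).trans (h.trans (by simp))
      intro t ht
      exact neg_le_neg (Set.mem_Iic.1 ht)
    have h4 := Real.log_le_log h1 h3
    rw [Real.log_exp] at h4
    linarith
end

section
/- Let A be a k×k real matrix with nonnegative entries, let c ∈ ℝ^k be a vector with all coordinates strictly positive, and suppose there exists a vector m ∈ ℝ^k with nonnegative coordinates such that m = c + A m. Then the spectral radius of A satisfies ρ(A) < 1. -/
open scoped ENNReal

/-- The spectral radius of a real square matrix: the supremum of the moduli of its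
complex eigenvalues, obtained as the spectral radius of the matrix viewed over `ℂ`. -/
noncomputable def matSpecRad {k : ℕ} (A : Matrix (Fin k) (Fin k) ℝ) : ℝ≥0∞ :=
  spectralRadius ℂ (A.map (Complex.ofReal ·))

theorem norm_lt_one_of_mem_spectrum {k : ℕ}
    (A : Matrix (Fin k) (Fin k) ℝ) (hA : ∀ i j, 0 ≤ A i j)
    (c : Fin k → ℝ) (hc : ∀ i, 0 < c i)
    (m : Fin k → ℝ) (hm : ∀ i, 0 ≤ m i)
    (heq : m = c + A.mulVec m) :
    ∀ z ∈ spectrum ℂ (A.map (Complex.ofReal ·)), ‖z‖ < 1 := by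
  have hmi : ∀ i, m i = c i + ∑ j, A i j * m j := fun i => congrFun heq i
  have hpos : ∀ i, 0 < m i := fun i => by
    rw [hmi i]
    exact add_pos_of_pos_of_nonneg (hc i)
      (Finset.sum_nonneg fun j _ => mul_nonneg (hA i j) (hm j))
  intro z hz
  rw [← Matrix.spectrum_toLin', ← Module.End.hasEigenvalue_iff_mem_spectrum] at hz
  obtain ⟨v, hv⟩ := hz.exists_hasEigenvector
  have hv0 : v ≠ 0 := hv.2
  have hve := hv.apply_eq_smul
  obtain ⟨i0, hi0⟩ := Function.ne_iff.mp hv0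
  obtain ⟨i, -, hi⟩ := Finset.exists_max_image Finset.univ (fun i => ‖v i‖ / m i)
    ⟨i0, Finset.mem_univ _⟩
  obtain ⟨t, ht⟩ : ∃ t, t = ‖v i‖ / m i := ⟨_, rfl⟩
  simp only [← ht] at hi
  have ht0 : 0 < t :=
    lt_of_lt_of_le (div_pos (norm_pos_iff.mpr hi0) (hpos i0)) (hi i0 (Finset.mem_univ _))
  have hle : ∀ j, ‖v j‖ ≤ t * m j := fun j =>
    (div_le_iff₀ (hpos j)).mp (hi j (Finset.mem_univ _))
  have hvi : ‖v i‖ = t * m i := by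
    rw [ht, div_mul_cancel₀ _ (hpos i).ne']
  have h1 : ∑ j, (A i j : ℂ) * v j = z * v i := congrFun hve i
  have h2 : ‖z‖ * ‖v i‖ ≤ t * ∑ j, A i j * m j := by
    rw [← norm_mul, ← h1, Finset.mul_sum]
    refine (norm_sum_le _ _).trans (Finset.sum_le_sum fun j _ => ?_)
    rw [norm_mul, Complex.norm_real, Real.norm_of_nonneg (hA i j)]
    calc A i j * ‖v j‖ ≤ A i j * (t * m j) := mul_le_mul_of_nonneg_left (hle j) (hA i j)
      _ = t * (A i j * m j) := by ring
  have h3 : t * ∑ j, A i j * m j < t * m i :=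
    mul_lt_mul_of_pos_left (by linarith [hmi i, hc i]) ht0
  have h4 : 0 < t * m i := mul_pos ht0 (hpos i)
  rw [hvi] at h2
  exact lt_of_mul_lt_mul_right (by rw [one_mul]; exact h2.trans_lt h3) h4.le

theorem iSup_nnnorm_lt_one (S : Set ℂ) (hfin : S.Finite) (key : ∀ z ∈ S, ‖z‖ < 1) :
    (⨆ z ∈ S, (‖z‖₊ : ℝ≥0∞)) < 1 := by
  have h1 : (⨆ z ∈ S, (‖z‖₊ : ℝ≥0∞)) ≤ hfin.toFinset.sup (fun z : ℂ => (‖z‖₊ : ℝ≥0∞)) :=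
    iSup₂_le fun z hz => Finset.le_sup (f := fun z : ℂ => (‖z‖₊ : ℝ≥0∞))
      (hfin.mem_toFinset.mpr hz)
  refine h1.trans_lt ?_
  rw [Finset.sup_lt_iff (by simp)]
  intro z hz
  have h2 : ‖z‖₊ < 1 := key z (hfin.mem_toFinset.mp hz)
  exact ENNReal.coe_lt_one_iff.mpr h2

/-- Let `A` be a `k×k` real matrix with nonnegative entries, `c ∈ ℝ^k`
with all coordinates strictly positive, and suppose there exists `m ∈ ℝ^k` with
nonnegative coordinates such that `m = c + A m`. Then `ρ(A) < 1`. -/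
theorem specRad_lt_one_of_nonneg_fixed_point {k : ℕ}
    (A : Matrix (Fin k) (Fin k) ℝ) (hA : ∀ i j, 0 ≤ A i j)
    (c : Fin k → ℝ) (hc : ∀ i, 0 < c i)
    (m : Fin k → ℝ) (hm : ∀ i, 0 ≤ m i)
    (heq : m = c + A.mulVec m) :
    matSpecRad A < 1 := by
  have key := norm_lt_one_of_mem_spectrum A hA c hc m hm heq
  have hfin : (spectrum ℂ (A.map (Complex.ofReal ·))).Finite := Matrix.finite_spectrum _
  exact iSup_nnnorm_lt_one _ hfin key
end

section
/- Let Θ ⊂ ℝ^d be compact, and let θ ↦ (d(θ), A(θ), B(θ), Γ(θ)) be continuous with values in ℝ^k × ℝ^{k×k} × ℝ^{k×k} × ℝ^{k×m}, with ρ(B(θ)) < 1 for all θ ∈ Θ. Let r ≥ 1 be a real number and let (Y_j)_{j≥0} and (X_j)_{j≥0} be sequences of random vectors in ℝ^k and ℝ^m respectively, such that each Y_j has the same distribution as Y_0, each X_j has the same distribution as X_0, and E[|Y_0|₁^r] < ∞, E[|X_0|₁^r] < ∞. Then for every θ the series λ(θ) = Σ_{j≥0} B(θ)^j (d(θ) +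 A(θ) Y_j + Γ(θ) X_j) converges absolutely almost surely, and E[(sup_{θ∈Θ} |λ(θ)|₁)^r] < ∞. -/
open MeasureTheory ProbabilityTheory
open scoped ENNReal

/-- The `ℓ¹` norm of a vector: `|x|₁ = Σ_i |x i|`. -/
def l1norm {k : ℕ} (x : Fin k → ℝ) : ℝ := ∑ i, |x i|

section LatentHelpers

open Filter Topology
open scoped Matrix.Norms.Operator

lemma latent_norm_map {k : ℕ} (M : Matrix (Fin k) (Fin k) ℝ) :
    ‖M.map (Complex.ofReal ·)‖ = ‖M‖ := by
  simp [Matrix.linfty_opNorm_def]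

lemma latent_norm_one_le {k : ℕ} : ‖(1 : Matrix (Fin k) (Fin k) ℝ)‖ ≤ 1 := by
  rw [← Matrix.diagonal_one, Matrix.linfty_opNorm_diagonal]
  exact (pi_norm_le_iff_of_nonneg zero_le_one).2 (fun i => by simp)

lemma latent_norm_pow_le {k : ℕ} (M : Matrix (Fin k) (Fin k) ℝ) (j : ℕ) :
    ‖M ^ j‖ ≤ ‖M‖ ^ j := by
  induction j with
  | zero => simpa using latent_norm_one_le
  | succ n ih =>
    rw [pow_succ, pow_succ]
    exact (norm_mul_le _ _).trans (by gcongr)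

lemma latent_pow_bound {k : ℕ} (M : Matrix (Fin k) (Fin k) ℝ) {t C : ℝ} {N : ℕ} (ht : 0 < t)
    (hC : 1 ≤ C) (hN : 0 < N) (h1 : ‖M ^ N‖ ≤ t ^ N) (h2 : ‖M‖ ≤ C * t) (j : ℕ) :
    ‖M ^ j‖ ≤ C ^ N * t ^ j := by
  calc ‖M ^ j‖ = ‖(M ^ N) ^ (j / N) * M ^ (j % N)‖ := by
        rw [← pow_mul, ← pow_add, Nat.div_add_mod]
    _ ≤ ‖M ^ N‖ ^ (j / N) * ‖M‖ ^ (j % N) :=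
        (norm_mul_le _ _).trans (mul_le_mul (latent_norm_pow_le _ _) (latent_norm_pow_le _ _)
          (norm_nonneg _) (by positivity))
    _ ≤ (t ^ N) ^ (j / N) * (C * t) ^ (j % N) := by gcongr
    _ = C ^ (j % N) * t ^ j := by
        conv_rhs => rw [← Nat.div_add_mod j N, pow_add, pow_mul]
        rw [Nat.div_add_mod, mul_pow]; ring
    _ ≤ C ^ N * t ^ j := by
        gcongr
        exact (Nat.mod_lt _ hN).le

lemma latent_gelfand {k : ℕ} (M : Matrix (Fin k) (Fin k) ℝ) (h : matSpecRad M < 1) :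
    ∃ (t : ℝ) (N : ℕ), 0 < t ∧ t < 1 ∧ 0 < N ∧ ‖M ^ N‖ < t ^ N := by
  obtain ⟨s, hs1, hs2⟩ := exists_between h
  have hs0 : s ≠ ⊤ := (hs2.trans ENNReal.one_lt_top).ne
  have : CompleteSpace (Matrix (Fin k) (Fin k) ℂ) := FiniteDimensional.complete ℂ _
  have hG := spectrum.pow_norm_pow_one_div_tendsto_nhds_spectralRadius
    (M.map (Complex.ofReal ·))
  obtain ⟨N, hN, hN0⟩ := ((hG.eventually_lt_const hs1).and (eventually_gt_atTop 0)).exists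
  have hs3 : 0 < s := lt_of_le_of_lt bot_le hs1
  refine ⟨s.toReal, N, ENNReal.toReal_pos hs3.ne' hs0, ?_, hN0, ?_⟩
  · simpa using (ENNReal.toReal_lt_toReal hs0 ENNReal.one_ne_top).2 hs2
  · have e : (M.map (Complex.ofReal ·)) ^ N = (M ^ N).map (Complex.ofReal ·) := by
      have := map_pow (Complex.ofRealHom.mapMatrix (m := Fin k)) M N
      exact this.symm
    rw [e, latent_norm_map, ENNReal.ofReal_lt_iff_lt_toReal (by positivity) hs0] at hN
    have h2 := pow_lt_pow_left₀ hN (by positivity) hN0.ne'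
    rwa [one_div, Real.rpow_inv_natCast_pow (norm_nonneg _) hN0.ne'] at h2

lemma latent_unif {d k : ℕ} (Θ : Set (Fin d → ℝ)) (hΘ : IsCompact Θ)
    (B : (Fin d → ℝ) → Matrix (Fin k) (Fin k) ℝ) (hB : ContinuousOn B Θ)
    (hρ : ∀ θ ∈ Θ, matSpecRad (B θ) < 1) :
    ∃ b : ℕ → ℝ, Summable b ∧ (∀ j, 0 ≤ b j) ∧ ∀ θ ∈ Θ, ∀ j, ‖B θ ^ j‖ ≤ b j := by
  refine hΘ.induction_on (p := fun S => ∃ b : ℕ → ℝ, Summable b ∧ (∀ j, 0 ≤ b j) ∧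
    ∀ θ ∈ S, ∀ j, ‖B θ ^ j‖ ≤ b j) ?_ ?_ ?_ ?_
  · exact ⟨fun _ => 0, summable_zero, fun _ => le_rfl, by simp⟩
  · rintro s t hst ⟨b, h1, h2, h3⟩
    exact ⟨b, h1, h2, fun θ hθ => h3 θ (hst hθ)⟩
  · rintro s t ⟨b, h1, h2, h3⟩ ⟨c, g1, g2, g3⟩
    refine ⟨fun j => b j + c j, h1.add g1, fun j => add_nonneg (h2 j) (g2 j), ?_⟩
    rintro θ (hθ | hθ) j
    · linarith [h3 θ hθ j, g2 j]
    · linarith [g3 θ hθ j, h2 j]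
  · intro θ hθ
    obtain ⟨t, N, ht, ht1, hN, hM⟩ := latent_gelfand (B θ) (hρ θ hθ)
    have hBc : ContinuousWithinAt B Θ θ := hB θ hθ
    have c1 : ContinuousWithinAt (fun x => ‖B x ^ N‖) Θ θ := (hBc.pow N).norm
    have c2 : ContinuousWithinAt (fun x => ‖B x‖) Θ θ := hBc.norm
    set C : ℝ := max 1 ((‖B θ‖ + 1) / t) with hC
    have hlt : ‖B θ‖ < C * t := by
      have : (‖B θ‖ + 1) / t ≤ C := le_max_right _ _
      rw [div_le_iff₀ ht] at this
      linarith
    have e1 := c1.eventually_lt_const hM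
    have e2 := c2.eventually_lt_const hlt
    refine ⟨{x | ‖B x ^ N‖ < t ^ N ∧ ‖B x‖ < C * t}, e1.and e2, fun j => C ^ N * t ^ j,
      (summable_geometric_of_lt_one ht.le ht1).mul_left _, fun j => by positivity, ?_⟩
    rintro x ⟨hx1, hx2⟩ j
    exact latent_pow_bound _ ht (le_max_left _ _) hN hx1.le hx2.le j

/-- Deterministic domination of the terms of the series, together with continuity. -/
lemma latent_det {d k m : ℕ} (Θ : Set (Fin d → ℝ)) (hΘ : IsCompact Θ)
    (dv : (Fin d → ℝ) → (Fin k → ℝ))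
    (A B : (Fin d → ℝ) → Matrix (Fin k) (Fin k) ℝ)
    (G : (Fin d → ℝ) → Matrix (Fin k) (Fin m) ℝ)
    (hdv : ContinuousOn dv Θ) (hA : ContinuousOn A Θ)
    (hB : ContinuousOn B Θ) (hG : ContinuousOn G Θ)
    (hρ : ∀ θ ∈ Θ, matSpecRad (B θ) < 1) :
    ∃ b : ℕ → ℝ, Summable b ∧ (∀ j, 0 ≤ b j) ∧ ∀ θ ∈ Θ, ∀ j, ∀ (y : Fin k → ℝ) (x : Fin m → ℝ),
      ‖(B θ ^ j).mulVec (dv θ + (A θ).mulVec y + (G θ).mulVec x)‖ ≤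
        b j * (1 + ‖y‖ + ‖x‖) := by
  obtain ⟨b, h1, h2, h3⟩ := latent_unif Θ hΘ B hB hρ
  obtain ⟨K1, hK1⟩ := hΘ.exists_bound_of_continuousOn hdv
  obtain ⟨K2, hK2⟩ := hΘ.exists_bound_of_continuousOn hA
  obtain ⟨K3, hK3⟩ := hΘ.exists_bound_of_continuousOn hG
  set K := |K1| + |K2| + |K3| with hK
  refine ⟨fun j => b j * K, h1.mul_right _, fun j => mul_nonneg (h2 j) (by positivity), ?_⟩
  intro θ hθ j y x
  have a1 : ‖dv θ‖ ≤ K := by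
    linarith [hK1 θ hθ, le_abs_self K1, abs_nonneg K2, abs_nonneg K3]
  have a2 : ‖A θ‖ ≤ K := by
    linarith [hK2 θ hθ, le_abs_self K2, abs_nonneg K1, abs_nonneg K3]
  have a3 : ‖G θ‖ ≤ K := by
    linarith [hK3 θ hθ, le_abs_self K3, abs_nonneg K2, abs_nonneg K1]
  calc _ ≤ ‖B θ ^ j‖ * ‖dv θ + (A θ).mulVec y + (G θ).mulVec x‖ :=
        Matrix.linfty_opNorm_mulVec _ _
    _ ≤ b j * (K + K * ‖y‖ + K * ‖x‖) := by
        apply mul_le_mul (h3 θ hθ j) _ (norm_nonneg _) (h2 j)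
        refine (norm_add₃_le).trans ?_
        have q1 := (Matrix.linfty_opNorm_mulVec (A θ) y).trans
          (mul_le_mul_of_nonneg_right a2 (norm_nonneg y))
        have q2 := (Matrix.linfty_opNorm_mulVec (G θ) x).trans
          (mul_le_mul_of_nonneg_right a3 (norm_nonneg x))
        linarith
    _ = _ := by ring

end LatentHelpers

section LatentProb

open Filter Topology

lemma latent_series_memLp {Ω : Type*} [MeasurableSpace Ω] (μ : Measure Ω)
    (b : ℕ → ℝ) (hb : Summable b) (hb0 : ∀ j, 0 ≤ b j) (Z : ℕ → Ω → ℝ)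
    (hZ0 : ∀ j ω, 0 ≤ Z j ω)
    (hZm : ∀ j, Measurable (Z j)) (p : ℝ≥0∞) (hp : 1 ≤ p) (C : ℝ≥0∞) (hC : C ≠ ⊤)
    (hZ : ∀ j, eLpNorm (Z j) p μ ≤ C) :
    (∀ᵐ ω ∂μ, Summable (fun j => b j * Z j ω)) ∧
      MemLp (fun ω => ∑' j, b j * Z j ω) p μ := by
  have hm : ∀ j, Measurable (fun ω => b j * Z j ω) := fun j => (hZm j).const_mul _
  have hle : ∀ j, eLpNorm (fun ω => b j * Z j ω) p μ ≤ ENNReal.ofReal (b j) * C := by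
    intro j
    have := eLpNorm_const_smul (b j) (Z j) p μ
    rw [Real.enorm_eq_ofReal (hb0 j)] at this
    change eLpNorm (b j • Z j) p μ ≤ _
    rw [this]
    gcongr
    exact hZ j
  have hfin : ∑' j, ENNReal.ofReal (b j) * C ≠ ⊤ := by
    rw [ENNReal.tsum_mul_right]
    exact ENNReal.mul_ne_top hb.tsum_ofReal_ne_top hC
  have hsum : ∀ᵐ ω ∂μ, Summable (fun j => b j * Z j ω) := by
    have := summable_norm_of_tsum_eLpNorm_ne_top (μ := μ) hp
      (fun j => (hm j).aestronglyMeasurable)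
      (ne_top_of_le_ne_top hfin (ENNReal.tsum_le_tsum hle))
    filter_upwards [this] with ω hω using hω.of_norm
  have hlim : ∀ᵐ ω ∂μ, Tendsto (fun n => (∑ j ∈ Finset.range n, fun ω => b j * Z j ω) ω) atTop
      (𝓝 (∑' j, b j * Z j ω)) := by
    filter_upwards [hsum] with ω hω
    simpa [Finset.sum_apply] using hω.hasSum.tendsto_sum_nat
  have hms : ∀ n, AEStronglyMeasurable (∑ j ∈ Finset.range n, fun ω => b j * Z j ω) μ :=
    fun n => Finset.aestronglyMeasurable_sum _ (fun j _ => (hm j).aestronglyMeasurable)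
  refine ⟨hsum, aestronglyMeasurable_of_tendsto_ae atTop hms hlim, ?_⟩
  refine lt_of_le_of_lt (Lp.eLpNorm_le_of_ae_tendsto (u := atTop) (Eventually.of_forall ?_)
    hms hlim) hfin.lt_top
  intro n
  refine (eLpNorm_sum_le (fun j _ => (hm j).aestronglyMeasurable) hp).trans ?_
  exact (Finset.sum_le_sum fun j _ => hle j).trans (ENNReal.sum_le_tsum _)

lemma latent_l1_le {k : ℕ} (x : Fin k → ℝ) : l1norm x ≤ k * ‖x‖ := by
  unfold l1norm
  calc ∑ i, |x i| ≤ ∑ _i : Fin k, ‖x‖ := Finset.sum_le_sum fun i _ => norm_le_pi_norm x i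
    _ = _ := by simp

lemma latent_l1_nonneg {k : ℕ} (x : Fin k → ℝ) : 0 ≤ l1norm x :=
  Finset.sum_nonneg fun _ _ => abs_nonneg _

lemma latent_norm_le_l1 {k : ℕ} (x : Fin k → ℝ) : ‖x‖ ≤ l1norm x := by
  refine (pi_norm_le_iff_of_nonneg (latent_l1_nonneg x)).2 fun i => ?_
  exact Finset.single_le_sum (f := fun i => |x i|) (fun i _ => abs_nonneg _) (Finset.mem_univ i)

lemma latent_l1_cont {k : ℕ} : Continuous (l1norm : (Fin k → ℝ) → ℝ) := by
  unfold l1norm; fun_prop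

lemma latent_memLp {k : ℕ} {Ω : Type*} [MeasurableSpace Ω] (μ : Measure Ω)
    (Y : Ω → (Fin k → ℝ)) (hY : Measurable Y) (r : ℝ) (hr : 1 ≤ r)
    (h : Integrable (fun ω => l1norm (Y ω) ^ r) μ) : MemLp Y (ENNReal.ofReal r) μ := by
  have h0 : ENNReal.ofReal r ≠ 0 := by simp; linarith
  rw [← integrable_norm_rpow_iff hY.aestronglyMeasurable h0 ENNReal.ofReal_ne_top,
    ENNReal.toReal_ofReal (by linarith)]
  refine h.mono' (hY.norm.pow_const r).aestronglyMeasurable (Eventually.of_forall fun ω => ?_)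
  rw [Real.norm_of_nonneg (by positivity)]
  exact Real.rpow_le_rpow (norm_nonneg _) (latent_norm_le_l1 _) (by linarith)

end LatentProb

/-- Let `Θ ⊂ ℝ^d` be compact, `θ ↦ (d(θ), A(θ), B(θ), Γ(θ))` continuous
with `ρ(B(θ)) < 1` on `Θ`, `r ≥ 1` real, and `(Y_j)`, `(X_j)` identically distributed
sequences of random vectors with `E[|Y₀|₁^r] < ∞` and `E[|X₀|₁^r] < ∞`. Then almost
surely, for every `θ ∈ Θ` the series `λ(θ) = Σ_j B(θ)^j (d(θ) + A(θ)Y_j + Γ(θ)X_j)`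
converges absolutely, and `E[(sup_{θ∈Θ} |λ(θ)|₁)^r] < ∞`. -/
theorem latent_series_sup_moment {d k m : ℕ}
    {Ω : Type*} [MeasurableSpace Ω] (μ : Measure Ω) [IsProbabilityMeasure μ]
    (Θ : Set (Fin d → ℝ)) (hΘ : IsCompact Θ)
    (dv : (Fin d → ℝ) → (Fin k → ℝ))
    (A B : (Fin d → ℝ) → Matrix (Fin k) (Fin k) ℝ)
    (G : (Fin d → ℝ) → Matrix (Fin k) (Fin m) ℝ)
    (hdv : ContinuousOn dv Θ) (hA : ContinuousOn A Θ)
    (hB : ContinuousOn B Θ) (hG : ContinuousOn G Θ)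
    (hρ : ∀ θ ∈ Θ, matSpecRad (B θ) < 1)
    (r : ℝ) (hr : 1 ≤ r)
    (Y : ℕ → Ω → (Fin k → ℝ)) (X : ℕ → Ω → (Fin m → ℝ))
    (hYmeas : ∀ j, Measurable (Y j)) (hXmeas : ∀ j, Measurable (X j))
    (hYid : ∀ j, IdentDistrib (Y j) (Y 0) μ μ)
    (hXid : ∀ j, IdentDistrib (X j) (X 0) μ μ)
    (hYmom : Integrable (fun ω => l1norm (Y 0 ω) ^ r) μ)
    (hXmom : Integrable (fun ω => l1norm (X 0 ω) ^ r) μ) :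
    (∀ᵐ ω ∂μ, ∀ θ ∈ Θ, Summable (fun j : ℕ =>
        l1norm ((B θ ^ j).mulVec (dv θ + (A θ).mulVec (Y j ω) + (G θ).mulVec (X j ω))))) ∧
    Integrable (fun ω =>
        (⨆ θ : Θ, l1norm (∑' j : ℕ,
          (B (θ : Fin d → ℝ) ^ j).mulVec
            (dv θ + (A (θ : Fin d → ℝ)).mulVec (Y j ω)
              + (G (θ : Fin d → ℝ)).mulVec (X j ω)))) ^ r) μ := by
  obtain ⟨b, hb, hb0, hbd⟩ := latent_det Θ hΘ dv A B G hdv hA hB hG hρ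
  have hYL := latent_memLp μ (Y 0) (hYmeas 0) r hr hYmom
  have hXL := latent_memLp μ (X 0) (hXmeas 0) r hr hXmom
  have hp : 1 ≤ ENNReal.ofReal r := by simpa using hr
  set p := ENNReal.ofReal r with hpdef
  have hZ : ∀ j, eLpNorm (fun ω => 1 + ‖Y j ω‖ + ‖X j ω‖) p μ ≤
      eLpNorm (fun _ : Ω => (1 : ℝ)) p μ + eLpNorm (Y 0) p μ + eLpNorm (X 0) p μ := by
    intro j
    rw [← (hYid j).eLpNorm_eq, ← (hXid j).eLpNorm_eq, ← eLpNorm_norm (Y j), ← eLpNorm_norm (X j)]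
    have m1 : AEStronglyMeasurable (fun ω => ‖Y j ω‖) μ := (hYmeas j).norm.aestronglyMeasurable
    have m2 : AEStronglyMeasurable (fun ω => ‖X j ω‖) μ := (hXmeas j).norm.aestronglyMeasurable
    have m0 : AEStronglyMeasurable (fun _ : Ω => (1 : ℝ)) μ := aestronglyMeasurable_const
    refine (eLpNorm_add_le (m0.add m1) m2 hp).trans ?_
    gcongr
    exact eLpNorm_add_le m0 m1 hp
  have hC : eLpNorm (fun _ : Ω => (1 : ℝ)) p μ + eLpNorm (Y 0) p μ + eLpNorm (X 0) p μ ≠ ⊤ :=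
    ENNReal.add_ne_top.2 ⟨ENNReal.add_ne_top.2 ⟨(memLp_const (1 : ℝ)).eLpNorm_ne_top,
      hYL.eLpNorm_ne_top⟩, hXL.eLpNorm_ne_top⟩
  obtain ⟨hsum, hmem⟩ := latent_series_memLp μ b hb hb0 (fun j ω => 1 + ‖Y j ω‖ + ‖X j ω‖)
    (fun j ω => by positivity)
    (fun j => (measurable_const.add (hYmeas j).norm).add (hXmeas j).norm) p hp _ hC hZ
  constructor
  · filter_upwards [hsum] with ω hω θ hθ
    refine Summable.of_nonneg_of_le (fun j => latent_l1_nonneg _) (fun j => ?_)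
      (hω.mul_left (k : ℝ))
    exact (latent_l1_le _).trans
      (mul_le_mul_of_nonneg_left (hbd θ hθ j _ _) (Nat.cast_nonneg k))
  · set T : Θ → ℕ → Ω → (Fin k → ℝ) := fun θ j ω => (B (θ : Fin d → ℝ) ^ j).mulVec
            (dv θ + (A (θ : Fin d → ℝ)).mulVec (Y j ω)
              + (G (θ : Fin d → ℝ)).mulVec (X j ω)) with hT
    set F : Ω → ℝ := fun ω => ⨆ θ : Θ, l1norm (∑' j : ℕ, T θ j ω) with hF
    have hF0 : ∀ ω, 0 ≤ F ω := fun ω => Real.iSup_nonneg fun θ => latent_l1_nonneg _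
    have hTb : ∀ θ j ω, ‖T θ j ω‖ ≤ b j * (1 + ‖Y j ω‖ + ‖X j ω‖) :=
      fun θ j ω => hbd θ θ.2 j _ _
    have hTc : ∀ j ω, Continuous (fun θ => T θ j ω) := by
      intro j ω
      have c1 : Continuous (fun θ : Θ => dv θ) := continuousOn_iff_continuous_domRestrict.1 hdv
      have c2 : Continuous (fun θ : Θ => A θ) := continuousOn_iff_continuous_domRestrict.1 hA
      have c3 : Continuous (fun θ : Θ => B θ) := continuousOn_iff_continuous_domRestrict.1 hB
      have c4 : Continuous (fun θ : Θ => G θ) := continuousOn_iff_continuous_domRestrict.1 hG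
      exact (c3.pow j).matrix_mulVec ((c1.add (c2.matrix_mulVec continuous_const)).add
        (c4.matrix_mulVec continuous_const))
    have hTm : ∀ θ j, Measurable (T θ j) := by
      intro θ j
      have hlin : ∀ {a c : ℕ} (M : Matrix (Fin a) (Fin c) ℝ),
          Measurable (fun v : Fin c → ℝ => M.mulVec v) := fun M =>
        (continuous_const.matrix_mulVec continuous_id).measurable
      exact (hlin _).comp ((measurable_const.add ((hlin _).comp (hYmeas j))).add
        ((hlin _).comp (hXmeas j)))
    have hsm : ∀ θ, AEMeasurable (fun ω => ∑' j, T θ j ω) μ := by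
      intro θ
      refine aemeasurable_of_tendsto_metrizable_ae Filter.atTop
        (f := fun n ω => ∑ j ∈ Finset.range n, T θ j ω)
        (fun n => (Finset.measurable_fun_sum _ fun j _ => hTm θ j).aemeasurable) ?_
      filter_upwards [hsum] with ω hω
      exact (Summable.of_norm_bounded hω (fun j => hTb θ j ω)).hasSum.tendsto_sum_nat
    obtain ⟨D, hDc, hDd⟩ := TopologicalSpace.exists_countable_dense Θ
    have : Countable D := hDc.to_subtype
    have hFm : AEMeasurable F μ := by
      have h1 : AEMeasurable (fun ω => ⨆ θ : D, l1norm (∑' j : ℕ, T θ j ω)) μ :=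
        AEMeasurable.iSup fun θ => latent_l1_cont.measurable.comp_aemeasurable (hsm θ)
      refine h1.congr ?_
      filter_upwards [hsum] with ω hω
      exact hDd.ciSup' (f := fun θ : Θ => l1norm (∑' j : ℕ, T θ j ω)) (latent_l1_cont.comp
        (continuous_tsum (fun j => hTc j ω) hω (fun j θ => hTb θ j ω)))
    have hFL : MemLp F p μ := by
      refine hmem.of_le_mul (c := k) hFm.aestronglyMeasurable ?_
      filter_upwards [hsum] with ω hω
      rw [Real.norm_of_nonneg (hF0 ω)]
      have hS0 : 0 ≤ ∑' j, b j * (1 + ‖Y j ω‖ + ‖X j ω‖) :=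
        tsum_nonneg fun j => mul_nonneg (hb0 j) (by positivity)
      rw [Real.norm_of_nonneg hS0]
      refine Real.iSup_le (fun θ => ?_) (by positivity)
      exact (latent_l1_le _).trans (mul_le_mul_of_nonneg_left
        (tsum_of_norm_bounded hω.hasSum (fun j => hTb θ j ω)) (Nat.cast_nonneg k))
    have h0 : p ≠ 0 := (zero_lt_one.trans_le hp).ne'
    have := hFL.integrable_norm_rpow h0 ENNReal.ofReal_ne_top
    rw [hpdef, ENNReal.toReal_ofReal (by linarith)] at this
    refine this.congr (Filter.Eventually.of_forall fun ω => ?_)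
    simp only [Real.norm_of_nonneg (hF0 ω)]
    rfl
end
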